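/- For every integer k ≥ 0, every k-spanner S has a perfect matching, this perfect matching is unique, and ν(S) = k + 5. In fact the unique perfect matching consists of the edge between the two central vertices together with the outer edge of each leg. -/

import Mathlib

open Finset

section Defs
variable {V : Type*}

/-- A matching: a set of edges, pairwise non-adjacent. -/
def IsMatchingSet (G : SimpleGraph V) (M : Finset (Sym2 V)) : Prop :=
  ↑M ⊆ G.edgeSet ∧ ∀ e ∈ M, ∀ f ∈ M, e ≠ f → ∀ v : V, v ∈ e → v ∉ f

/-- A vertex is saturated by a matching if some edge of it is incident to the vertex. -/
def Saturates (M : Finset (Sym2 V)) (v : V) : Prop :=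
  ∃ e ∈ M, v ∈ e

/-- ν(G): maximum size of a matching. -/
noncomputable def nuG (G : SimpleGraph V) : ℕ :=
  sSup {n | ∃ M : Finset (Sym2 V), IsMatchingSet G M ∧ M.card = n}

/-- λ(G): maximum of |H| + |H'| over pairs of disjoint matchings. -/
noncomputable def lamG (G : SimpleGraph V) : ℕ :=
  sSup {n | ∃ H H' : Finset (Sym2 V), IsMatchingSet G H ∧ IsMatchingSet G H' ∧
    Disjoint H H' ∧ H.card + H'.card = n}

/-- Λ(G): set of pairs of disjoint matchings realizing λ(G). -/
def LambdaSet (G : SimpleGraph V) : Set (Finset (Sym2 V) × Finset (Sym2 V)) :=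
  {p | IsMatchingSet G p.1 ∧ IsMatchingSet G p.2 ∧ Disjoint p.1 p.2 ∧
    p.1.card + p.2.card = lamG G}

/-- μ(G): maximum of |H| over pairs (H, H') ∈ Λ(G). -/
noncomputable def muG (G : SimpleGraph V) : ℕ :=
  sSup {n | ∃ p ∈ LambdaSet G, p.1.card = n}

/-- Λ_μ(G): pairs in Λ(G) with |H| = μ(G). -/
def LambdaMuSet (G : SimpleGraph V) : Set (Finset (Sym2 V) × Finset (Sym2 V)) :=
  {p | p ∈ LambdaSet G ∧ p.1.card = muG G}

end Defs

/-- Vertex type of a k-spanner: two central vertices and 4+k legs of two vertices each. -/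
abbrev SpannerV (k : ℕ) : Type := Fin 2 ⊕ (Fin (4 + k) × Fin 2)

/-- The k-spanner determined by the attachment function `attach` assigning each of
the 4+k legs to one of the two central vertices.  Leg `i` consists of the middle
vertex `Sum.inr (i, 0)` and the leaf `Sum.inr (i, 1)`; its inner edge joins the
central vertex `Sum.inl (attach i)` to `Sum.inr (i, 0)` and its outer edge joins
`Sum.inr (i, 0)` to `Sum.inr (i, 1)`. The two central vertices are adjacent. -/
def spannerGraph (k : ℕ) (attach : Fin (4 + k) → Fin 2) : SimpleGraph (SpannerV k) :=
  SimpleGraph.fromRel (fun u v =>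
    (u = Sum.inl 0 ∧ v = Sum.inl 1) ∨
    (∃ i : Fin (4 + k), u = Sum.inl (attach i) ∧ v = Sum.inr (i, 0)) ∨
    (∃ i : Fin (4 + k), u = Sum.inr (i, 0) ∧ v = Sum.inr (i, 1)))

/-- `attach` describes a genuine k-spanner: at least two legs attached to each
central vertex (the base spanner already has two legs at each). -/
def IsKSpannerAttach (k : ℕ) (attach : Fin (4 + k) → Fin 2) : Prop :=
  2 ≤ (Finset.univ.filter fun i => attach i = 0).card ∧
  2 ≤ (Finset.univ.filter fun i => attach i = 1).card

section Matching
variable {V : Type*} {G : SimpleGraph V}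

theorem IsMatchingSet.eq_of_mem {M : Finset (Sym2 V)} (hM : IsMatchingSet G M) {e f : Sym2 V}
    (he : e ∈ M) (hf : f ∈ M) {v : V} (hve : v ∈ e) (hvf : v ∈ f) : e = f := by
  by_contra h
  exact hM.2 e he f hf h v hve hvf

theorem IsMatchingSet.two_mul_card_le [Fintype V] {M : Finset (Sym2 V)}
    (hM : IsMatchingSet G M) : 2 * M.card ≤ Fintype.card V := by
  classical
  have hdisj : (M : Set (Sym2 V)).PairwiseDisjoint Sym2.toFinset := by
    intro e he f hf hef
    refine Finset.disjoint_left.mpr fun v hve hvf => ?_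
    exact hM.2 e he f hf hef v (Sym2.mem_toFinset.mp hve) (Sym2.mem_toFinset.mp hvf)
  have hcard : (M.biUnion Sym2.toFinset).card = M.card * 2 := by
    rw [Finset.card_biUnion hdisj]
    exact Finset.sum_const_nat fun e he =>
      Sym2.card_toFinset_of_not_isDiag e (G.not_isDiag_of_mem_edgeSet (hM.1 he))
  rw [mul_comm, ← hcard]
  exact Finset.card_le_univ _

/-- A saturating set of edges contained in a matching is the whole matching. -/
theorem IsMatchingSet.eq_of_subset {M N : Finset (Sym2 V)} (hM : IsMatchingSet G M)
    (hNM : N ⊆ M) (hN : ∀ v, Saturates N v) : M = N := by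
  refine Finset.Subset.antisymm (fun e he => ?_) hNM
  obtain ⟨v, hv⟩ : ∃ v, v ∈ e := ⟨_, e.out_fst_mem⟩
  obtain ⟨f, hf, hvf⟩ := hN v
  rwa [hM.eq_of_mem he (hNM hf) hv hvf]

theorem IsMatchingSet.exists_adj {M : Finset (Sym2 V)} (hM : IsMatchingSet G M) {v : V}
    (hv : Saturates M v) : ∃ w, G.Adj v w ∧ s(v, w) ∈ M := by
  obtain ⟨e, he, w, rfl⟩ := hv
  exact ⟨w, hM.1 he, he⟩

/-- A matching with half as many edges as there are vertices is maximum. -/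
theorem nuG_eq_card [Fintype V] {M : Finset (Sym2 V)} (hM : IsMatchingSet G M)
    (hcard : 2 * M.card = Fintype.card V) : nuG G = M.card := by
  refine IsGreatest.csSup_eq ⟨⟨M, hM, rfl⟩, ?_⟩
  rintro n ⟨N, hN, rfl⟩
  have := hN.two_mul_card_le
  omega

end Matching

section Spanner
variable {k : ℕ} {attach : Fin (4 + k) → Fin 2}

/-- The central edge together with the outer edge of each leg. -/
def spannerMatching (k : ℕ) : Finset (Sym2 (SpannerV k)) :=
  insert s((Sum.inl 0 : SpannerV k), Sum.inl 1)
    (Finset.univ.image fun i : Fin (4 + k) =>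
      s((Sum.inr (i, 0) : SpannerV k), Sum.inr (i, 1)))

theorem mem_spannerMatching {e : Sym2 (SpannerV k)} :
    e ∈ spannerMatching k ↔ e = s(Sum.inl 0, Sum.inl 1) ∨
      ∃ i : Fin (4 + k), s(Sum.inr (i, 0), Sum.inr (i, 1)) = e := by
  simp [spannerMatching]

theorem isMatchingSet_spannerMatching :
    IsMatchingSet (spannerGraph k attach) (spannerMatching k) := by
  refine ⟨fun e he => ?_, fun e he f hf hef v hve hvf => hef ?_⟩
  · rcases mem_spannerMatching.mp he with rfl | ⟨i, rfl⟩ <;> simp [spannerGraph]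
  · rcases mem_spannerMatching.mp he with rfl | ⟨i, rfl⟩ <;>
    rcases mem_spannerMatching.mp hf with rfl | ⟨j, rfl⟩ <;>
    rcases Sym2.mem_iff.mp hve with rfl | rfl <;> simp_all

theorem saturates_spannerMatching (v : SpannerV k) : Saturates (spannerMatching k) v := by
  rcases v with c | ⟨i, c⟩
  · exact ⟨_, mem_spannerMatching.mpr (Or.inl rfl), by fin_cases c <;> simp⟩
  · exact ⟨_, mem_spannerMatching.mpr (Or.inr ⟨i, rfl⟩), by fin_cases c <;> simp⟩

theorem card_spannerMatching : (spannerMatching k).card = k + 5 := by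
  rw [spannerMatching, Finset.card_insert_of_notMem (by simp), Finset.card_image_of_injective,
    Finset.card_univ, Fintype.card_fin]
  · omega
  · intro i j h
    simpa using h

theorem spannerGraph_adj_leaf {i : Fin (4 + k)} {w : SpannerV k}
    (h : (spannerGraph k attach).Adj (Sum.inr (i, 1)) w) : w = Sum.inr (i, 0) := by
  simp [spannerGraph] at h
  grind

theorem spannerGraph_adj_center {w : SpannerV k}
    (h : (spannerGraph k attach).Adj (Sum.inl 0) w) :
    w = Sum.inl 1 ∨ ∃ i, w = Sum.inr (i, 0) := by
  simp [spannerGraph] at h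
  grind

theorem spannerMatching_subset {M : Finset (Sym2 (SpannerV k))}
    (hM : IsMatchingSet (spannerGraph k attach) M) (hsat : ∀ v, Saturates M v) :
    spannerMatching k ⊆ M := by
  have outer (i : Fin (4 + k)) :
      s((Sum.inr (i, 0) : SpannerV k), Sum.inr (i, 1)) ∈ M := by
    obtain ⟨w, hw, hwM⟩ := hM.exists_adj (hsat (Sum.inr (i, 1)))
    rwa [spannerGraph_adj_leaf hw, Sym2.eq_swap] at hwM
  intro e he
  rcases mem_spannerMatching.mp he with rfl | ⟨i, rfl⟩
  · obtain ⟨w, hw, hwM⟩ := hM.exists_adj (hsat (Sum.inl 0))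
    rcases spannerGraph_adj_center hw with rfl | ⟨i, rfl⟩
    · exact hwM
    · have := hM.eq_of_mem hwM (outer i) (v := Sum.inr (i, 0)) (by simp) (by simp)
      simp at this
  · exact outer i

end Spanner

/-- Every k-spanner has a unique perfect matching, consisting of the central edge
together with the outer edge of each leg, and ν(S) = k + 5. -/
theorem stmt5 (k : ℕ) (attach : Fin (4 + k) → Fin 2) (hat : IsKSpannerAttach k attach) :
    letI S := spannerGraph k attach
    letI M₀ : Finset (Sym2 (SpannerV k)) :=
      insert s((Sum.inl 0 : SpannerV k), Sum.inl 1)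
        (Finset.univ.image fun i : Fin (4 + k) =>
          s((Sum.inr (i, 0) : SpannerV k), Sum.inr (i, 1)))
    (IsMatchingSet S M₀ ∧ ∀ v : SpannerV k, Saturates M₀ v) ∧
    (∀ M : Finset (Sym2 (SpannerV k)),
      IsMatchingSet S M → (∀ v : SpannerV k, Saturates M v) → M = M₀) ∧
    nuG S = k + 5 := by
  exact ⟨⟨isMatchingSet_spannerMatching, saturates_spannerMatching⟩,
    fun _ hM hsat => hM.eq_of_subset (spannerMatching_subset hM hsat) saturates_spannerMatching,
    (nuG_eq_card isMatchingSet_spannerMatching (by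
      rw [card_spannerMatching]
      simp
      omega)).trans card_spannerMatching⟩
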